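/- arXiv:2310.19101 — 2 statements merged into one kernel-verified Lean document; each statement's English description precedes it below -/
import Mathlib

section
/- Let r > 0, let u_n : (0,r) → ℝ be a sequence of continuous functions, let λ_n be real numbers with λ_n → +∞, set Δ_r = {(s,t) ∈ ℝ² : 0 < s < t < r} and E_n = {(s,t) ∈ Δ_r : u_n(t) − u_n(s) > ∫_s^t u_n(ξ)² dξ + λ_n (t − s)}. Let ε_n^+ = {t ∈ (0,r) : u_n(t) > 0}, for t ∈ ε_n^+ let a_n(t) = inf of the connected component of ε_n^+ containing t, let E_n'' = E_n ∩ ((0,r) × ε_n^+), let E_n^* = {(s,t) ∈ E_n : t ∈ ε_n^+ and (s, a_n(t)) ∈ E_n}, and let E_n^{**} = E_n'' \ E_n^*. Then mes₂(E_n^{**}) → 0 as n → ∞. -/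
open MeasureTheory Metric Filter

lemma aux_slice (l : ℝ) (hl : 0 < l) (K K' : ℝ → ℝ) (G : Set ℝ) (hG : MeasurableSet G)
    (hK : ∀ x ∈ G, HasDerivAt K (K' x) x) (hinj : Set.InjOn K G)
    (hb : ∀ x ∈ G, (K x) ^ 2 / 4 + l ≤ K' x) :
    volume G ≤ ENNReal.ofReal (2 * Real.pi / Real.sqrt l) := by
  have hs : 0 < Real.sqrt l := Real.sqrt_pos.2 hl
  have hsq : Real.sqrt l ^ 2 = l := Real.sq_sqrt hl.le
  set q := Real.sqrt l with hq
  have h1 := lintegral_image_eq_lintegral_abs_deriv_mul (s := G)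
    (f := fun x => Real.arctan (K x / (2 * q)))
    (f' := fun x => 1 / (1 + (K x / (2 * q)) ^ 2) * (K' x / (2 * q))) hG
    (fun x hx => (((hK x hx).div_const (2 * q)).arctan).hasDerivWithinAt)
    (by
      intro x hx y hy hxy
      have := Real.arctan_injective hxy
      apply hinj hx hy
      field_simp at this
      exact this) (fun _ => 1)
  simp only [mul_one, lintegral_const, one_mul, Measure.restrict_apply MeasurableSet.univ,
    Set.univ_inter] at h1
  have h2 : volume ((fun x => Real.arctan (K x / (2 * q))) '' G) ≤ ENNReal.ofReal Real.pi := by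
    calc _ ≤ volume (Set.Ioo (-(Real.pi / 2)) (Real.pi / 2)) := by
          apply measure_mono
          rintro _ ⟨x, _, rfl⟩
          exact Real.arctan_mem_Ioo _
      _ = _ := by rw [Real.volume_Ioo]; congr 1; ring
  have h3 : ENNReal.ofReal (q / 2) * volume G ≤ ENNReal.ofReal Real.pi := by
    refine le_trans ?_ (h1 ▸ h2)
    rw [← setLIntegral_const]
    apply setLIntegral_mono' hG
    intro x hx
    apply ENNReal.ofReal_le_ofReal
    refine le_trans ?_ (le_abs_self _)
    have hbx := hb x hx
    have : 1 / (1 + (K x / (2 * q)) ^ 2) * (K' x / (2 * q))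
        = K' x * (q / 2) / ((K x) ^ 2 / 4 + q ^ 2) := by
      field_simp
      try ring
    rw [this, le_div_iff₀ (by positivity), hsq]
    nlinarith
  have h4 : ENNReal.ofReal (2 * Real.pi / q) = ENNReal.ofReal Real.pi / ENNReal.ofReal (q / 2) := by
    rw [← ENNReal.ofReal_div_of_pos (by positivity)]
    congr 1
    field_simp
  rw [h4, ENNReal.le_div_iff_mul_le (Or.inl (by simpa using hs)) (Or.inl ENNReal.ofReal_ne_top),
    mul_comm]
  exact h3

lemma aux_bound (r : ℝ) (hr : 0 < r) (u : ℝ → ℝ) (hu : ContinuousOn u (Set.Ioo 0 r)) (l : ℝ) (hl : 0 < l) :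
    volume {p : ℝ × ℝ | 0 < p.1 ∧ p.1 < p.2 ∧ p.2 < r ∧
      (∫ ξ in p.1..p.2, (u ξ) ^ 2) + l * (p.2 - p.1) < u p.2 - u p.1}
      ≤ 2 * (ENNReal.ofReal (2 * Real.pi / Real.sqrt l) * ENNReal.ofReal r) := by
  set I := Set.Ioo 0 r with hI
  have hIo : IsOpen I := isOpen_Ioo
  have hm : r / 2 ∈ I := ⟨by linarith, by linarith⟩
  have hsub : ∀ x ∈ I, ∀ y ∈ I, Set.uIcc x y ⊆ I := fun x hx y hy =>
    Set.OrdConnected.uIcc_subset Set.ordConnected_Ioo hx hy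
  have hint : ∀ x ∈ I, ∀ y ∈ I, IntervalIntegrable (fun ξ => (u ξ) ^ 2) volume x y :=
    fun x hx y hy => ((hu.pow 2).mono (hsub x hx y hy)).intervalIntegrable
  set Φ : ℝ → ℝ := fun x => (∫ ξ in (r / 2)..x, (u ξ) ^ 2) + l * x with hΦ
  have hd : ∀ x ∈ I, HasDerivAt Φ ((u x) ^ 2 + l) x := by
    intro x hx
    have h1 : HasDerivAt (fun x => ∫ ξ in (r / 2)..x, (u ξ) ^ 2) ((u x) ^ 2) x :=
      intervalIntegral.integral_hasDerivAt_right (hint _ hm _ hx)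
        ((hu.pow 2).stronglyMeasurableAtFilter hIo x hx)
        ((hu.pow 2).continuousAt (hIo.mem_nhds hx))
    have h2 : HasDerivAt (fun x => l * x) l x := by simpa using (hasDerivAt_id x).const_mul l
    exact h1.add h2
  have hc : ContinuousOn Φ I := fun x hx => (hd x hx).continuousAt.continuousWithinAt
  have hdiff : ∀ x ∈ I, ∀ y ∈ I, Φ y - Φ x = (∫ ξ in x..y, (u ξ) ^ 2) + l * (y - x) := by
    intro x hx y hy
    rw [← intervalIntegral.integral_interval_sub_left (hint _ hm _ hy) (hint _ hm _ hx)]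
    simp only [hΦ]; ring
  have hlt : ∀ x ∈ I, ∀ y ∈ I, x < y → 0 < Φ y - Φ x := by
    intro x hx y hy hxy
    rw [hdiff x hx y hy]
    have := intervalIntegral.integral_nonneg (μ := volume) hxy.le (f := fun ξ => (u ξ) ^ 2)
      (fun ξ _ => sq_nonneg _)
    have := mul_pos hl (sub_pos.2 hxy)
    linarith
  have hinj : Set.InjOn Φ I := by
    intro x hx y hy hxy
    rcases lt_trichotomy x y with h | h | h
    · have := hlt x hx y hy h; linarith
    · exact h
    · have := hlt y hy x hx h; linarith
  set A : Set (ℝ × ℝ) := (I ×ˢ I) ∩ (fun p : ℝ × ℝ => |u p.2| - |Φ p.2 - Φ p.1| / 2) ⁻¹' Set.Ioi 0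
    with hA
  have c1 : ContinuousOn (fun p : ℝ × ℝ => Φ p.1) (I ×ˢ I) :=
    hc.comp continuousOn_fst (fun p hp => hp.1)
  have c2 : ContinuousOn (fun p : ℝ × ℝ => Φ p.2) (I ×ˢ I) :=
    hc.comp continuousOn_snd (fun p hp => hp.2)
  have c3 : ContinuousOn (fun p : ℝ × ℝ => u p.2) (I ×ˢ I) :=
    hu.comp continuousOn_snd (fun p hp => hp.2)
  have hAm : MeasurableSet A :=
    ((c3.abs.sub ((c2.sub c1).abs.div_const 2)).isOpen_inter_preimage (hIo.prod hIo)
      isOpen_Ioi).measurableSet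
  have hAv : volume A ≤ ENNReal.ofReal (2 * Real.pi / Real.sqrt l) * ENNReal.ofReal r := by
    rw [Measure.volume_eq_prod, Measure.prod_apply hAm]
    calc _ ≤ ∫⁻ s, I.indicator (fun _ => ENNReal.ofReal (2 * Real.pi / Real.sqrt l)) s := by
          apply lintegral_mono
          intro s
          by_cases hs : s ∈ I
          · simp only [Set.indicator_of_mem hs]
            apply aux_slice l hl (fun x => Φ x - Φ s) (fun x => (u x) ^ 2 + l) _
              (measurable_prodMk_left hAm)
            · intro x hx
              exact (hd x hx.1.2).sub_const _
            · intro x hx y hy hxy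
              exact hinj hx.1.2 hy.1.2 (by simpa using hxy)
            · intro x hx
              have h := hx.2
              simp only [Set.mem_preimage, Set.mem_Ioi] at h
              have h0 := abs_nonneg (Φ x - Φ s)
              have h5 := sq_abs (Φ x - Φ s)
              have h6 := sq_abs (u x)
              nlinarith
          · have : Prod.mk s ⁻¹' A = ∅ := by
              ext x
              simp only [Set.mem_preimage, Set.mem_empty_iff_false, iff_false]
              exact fun h => hs h.1.1
            simp [this]
      _ = _ := by
          rw [lintegral_indicator hIo.measurableSet, setLIntegral_const, hI, Real.volume_Ioo,
            sub_zero]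
  have hB : volume (Prod.swap ⁻¹' A) = volume A := by
    rw [Measure.volume_eq_prod]
    exact (Measure.measurePreserving_swap).measure_preimage hAm.nullMeasurableSet
  calc _ ≤ volume (A ∪ Prod.swap ⁻¹' A) := by
        apply measure_mono
        rintro ⟨s, t⟩ ⟨h1, h2, h3, h4⟩
        simp only at h1 h2 h3 h4
        have hs : s ∈ I := ⟨h1, h2.trans h3⟩
        have ht : t ∈ I := ⟨h1.trans h2, h3⟩
        rw [← hdiff s hs t ht] at h4
        have h5 := hlt s hs t ht h2
        have h6 := le_abs_self (u t)
        have h7 := neg_le_abs (u s)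
        by_cases h : (Φ t - Φ s) / 2 < u t
        · left
          refine ⟨⟨hs, ht⟩, ?_⟩
          simp only [Set.mem_preimage, Set.mem_Ioi]
          rw [abs_of_pos h5]
          linarith
        · right
          refine ⟨⟨ht, hs⟩, ?_⟩
          simp only [Set.mem_preimage, Set.mem_Ioi, Prod.swap_prod_mk]
          rw [abs_sub_comm, abs_of_pos h5]
          linarith
    _ ≤ volume A + volume (Prod.swap ⁻¹' A) := measure_union_le _ _
    _ ≤ _ := by
        rw [hB, two_mul]
        exact add_le_add hAv hAv

theorem statement17 (r : ℝ) (hr : 0 < r) (u : ℕ → ℝ → ℝ)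
    (hu : ∀ n, ContinuousOn (u n) (Set.Ioo 0 r))
    (lam : ℕ → ℝ) (hlam : Tendsto lam atTop atTop)
    (E : ℕ → Set (ℝ × ℝ))
    (hE : ∀ n, E n = {p : ℝ × ℝ | 0 < p.1 ∧ p.1 < p.2 ∧ p.2 < r ∧
      (∫ ξ in p.1..p.2, (u n ξ) ^ 2) + lam n * (p.2 - p.1) < u n p.2 - u n p.1})
    (εp : ℕ → Set ℝ) (hεp : ∀ n, εp n = {t ∈ Set.Ioo 0 r | 0 < u n t})
    (a : ℕ → ℝ → ℝ) (ha : ∀ n, ∀ t ∈ εp n, a n t = sInf (connectedComponentIn (εp n) t))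
    (Estar : ℕ → Set (ℝ × ℝ))
    (hEstar : ∀ n, Estar n = {p : ℝ × ℝ | p ∈ E n ∧ p.2 ∈ εp n ∧ (p.1, a n p.2) ∈ E n}) :
    Tendsto (fun n => volume ((E n ∩ Set.Ioo 0 r ×ˢ εp n) \ Estar n))
      atTop (nhds 0) := by
  have hlim : Tendsto (fun n => 2 * (ENNReal.ofReal (2 * Real.pi / Real.sqrt (lam n)) *
      ENNReal.ofReal r)) atTop (nhds 0) := by
    have h1 : Tendsto (fun n => 2 * Real.pi / Real.sqrt (lam n)) atTop (nhds 0) :=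
      (Real.tendsto_sqrt_atTop.comp hlam).const_div_atTop _
    have h2 := ENNReal.tendsto_ofReal h1
    rw [ENNReal.ofReal_zero] at h2
    have h3 := ENNReal.Tendsto.mul_const (b := ENNReal.ofReal r) h2 (Or.inr ENNReal.ofReal_ne_top)
    have h4 := ENNReal.Tendsto.const_mul (a := 2) h3 (Or.inr (by simp))
    simpa using h4
  refine tendsto_of_tendsto_of_tendsto_of_le_of_le' tendsto_const_nhds hlim
    (Eventually.of_forall fun _ => zero_le) ?_
  filter_upwards [hlam.eventually_gt_atTop 0] with n hn
  refine le_trans (measure_mono ?_) (aux_bound r hr (u n) (hu n) (lam n) hn)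
  rw [← hE n]
  exact fun p hp => hp.1.1
end

section
/- Let r₀ > 0 and for integers n with n > r₀ define S_n : [0, r₀] → ℝ by S_n(x) = −(n²/r₀)·x for x ∈ [0, r₀/n) and S_n(x) = −n·(r₀ − x)/(r₀·(1 − r₀/n)) for x ∈ [r₀/n, r₀]. Then: (1) S_n(x) ≤ 0 for all n > r₀ and all x ∈ [0, r₀], so in particular the sequence S_n does not tend to +∞ in Lebesgue measure on (0, r₀); and (2) the differences S_n(t) − S_n(s) tend to +∞ in two-dimensional Lebesgue measure on the triangle Δ_{r₀} = {(s,t) ∈ ℝ² : 0 < s < t < r₀}, i.e., for every A > 0, mes₂({(s,t) ∈ Δ_{r₀} : S_n(t) − S_n(s) ≤ A}) → 0 as n → ∞. -/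
open MeasureTheory Metric Filter

theorem statement18 (r₀ : ℝ) (hr₀ : 0 < r₀) (S : ℕ → ℝ → ℝ)
    (hS : ∀ n : ℕ, r₀ < n → ∀ x ∈ Set.Icc 0 r₀,
      S n x = if x < r₀ / n then -(n ^ 2 / r₀) * x
              else -(n * (r₀ - x)) / (r₀ * (1 - r₀ / n))) :
    (∀ n : ℕ, r₀ < n → ∀ x ∈ Set.Icc 0 r₀, S n x ≤ 0) ∧
    ¬ (∀ A > (0:ℝ), Tendsto (fun n => volume {x ∈ Set.Ioo 0 r₀ | S n x ≤ A})
        atTop (nhds 0)) ∧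
    (∀ A > (0:ℝ), Tendsto (fun n => volume {p : ℝ × ℝ | 0 < p.1 ∧ p.1 < p.2 ∧ p.2 < r₀ ∧
        S n p.2 - S n p.1 ≤ A}) atTop (nhds 0)) := by
  have hpos : ∀ n : ℕ, r₀ < n → 0 < 1 - r₀ / n := by
    intro n hn
    have : r₀ / n < 1 := (div_lt_one (hr₀.trans hn)).2 hn
    linarith
  have h1 : ∀ n : ℕ, r₀ < n → ∀ x ∈ Set.Icc 0 r₀, S n x ≤ 0 := by
    intro n hn x hx
    rw [hS n hn x hx]
    have h0 := hpos n hn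
    have hx0 := hx.1
    have hx1 : 0 ≤ r₀ - x := sub_nonneg.2 hx.2
    split_ifs
    · have : 0 ≤ (n:ℝ) ^ 2 / r₀ * x := by positivity
      linarith
    · rw [neg_div]
      have : 0 ≤ (n * (r₀ - x)) / (r₀ * (1 - r₀ / n)) := by positivity
      linarith
  have hev : ∀ᶠ n : ℕ in atTop, r₀ < n :=
    tendsto_natCast_atTop_atTop.eventually (eventually_gt_atTop r₀)
  refine ⟨h1, ?_, ?_⟩
  · intro h
    have h2 := h 1 one_pos
    have h3 : Tendsto (fun n => volume {x ∈ Set.Ioo 0 r₀ | S n x ≤ 1}) atTop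
        (nhds (ENNReal.ofReal r₀)) := by
      apply tendsto_const_nhds.congr'
      filter_upwards [hev] with n hn
      have : {x ∈ Set.Ioo 0 r₀ | S n x ≤ 1} = Set.Ioo 0 r₀ := by
        ext x
        constructor
        · exact fun h => h.1
        · exact fun h => ⟨h, (h1 n hn x ⟨h.1.le, h.2.le⟩).trans zero_le_one⟩
      rw [this, Real.volume_Ioo, sub_zero]
    have h4 := tendsto_nhds_unique h2 h3
    have := ENNReal.ofReal_pos.2 hr₀
    rw [← h4] at this
    exact lt_irrefl _ this
  · intro A hA
    have hlim : Tendsto (fun n : ℕ => ENNReal.ofReal (r₀ / n) * ENNReal.ofReal r₀ +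
        ENNReal.ofReal ((A + 1) * r₀ / n) * ENNReal.ofReal r₀) atTop (nhds 0) := by
      have key : ∀ c : ℝ, Tendsto (fun n : ℕ => ENNReal.ofReal (c / n) * ENNReal.ofReal r₀)
          atTop (nhds 0) := by
        intro c
        have h := ENNReal.tendsto_ofReal (tendsto_const_div_atTop_nhds_zero_nat c)
        have h' := ENNReal.Tendsto.mul_const (b := ENNReal.ofReal r₀) h
          (Or.inr ENNReal.ofReal_ne_top)
        simpa using h'
      simpa using (key r₀).add (key ((A + 1) * r₀))
    refine tendsto_of_tendsto_of_tendsto_of_le_of_le' tendsto_const_nhds hlim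
      (Eventually.of_forall fun _ => zero_le) ?_
    filter_upwards [hev] with n hn
    have hn0 : (0:ℝ) < n := hr₀.trans hn
    have hsub : {p : ℝ × ℝ | 0 < p.1 ∧ p.1 < p.2 ∧ p.2 < r₀ ∧ S n p.2 - S n p.1 ≤ A} ⊆
        (Set.Ioo 0 (r₀ / n) ×ˢ Set.Ioo 0 r₀) ∪
        regionBetween (fun s => s) (fun s => s + (A + 1) * r₀ / n) (Set.Ioo 0 r₀) := by
      rintro ⟨s, t⟩ ⟨hs, hst, ht, hA'⟩
      simp only at hs hst ht hA'
      by_cases hc : s < r₀ / n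
      · exact Or.inl ⟨⟨hs, hc⟩, ⟨hs.trans hst, ht⟩⟩
      · right
        refine ⟨⟨hs, hst.trans ht⟩, hst, ?_⟩
        have hct : ¬ t < r₀ / n := fun h => hc (hst.trans h)
        rw [hS n hn s ⟨hs.le, (hst.trans ht).le⟩, hS n hn t ⟨(hs.trans hst).le, ht.le⟩,
          if_neg hc, if_neg hct, ← sub_div, div_le_iff₀ (mul_pos hr₀ (hpos n hn))] at hA'
        have h5 : A * (r₀ * (1 - r₀ / n)) ≤ A * r₀ := by
          have : 0 < r₀ / n := by positivity
          have : r₀ * (1 - r₀ / n) ≤ r₀ := by nlinarith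
          exact mul_le_mul_of_nonneg_left this hA.le
        have : t - s < (A + 1) * r₀ / n := by
          rw [lt_div_iff₀ hn0]
          nlinarith
        show t < s + (A + 1) * r₀ / n
        linarith
    refine (measure_mono hsub).trans ((measure_union_le _ _).trans (add_le_add ?_ ?_))
    · rw [Measure.volume_eq_prod, Measure.prod_prod, Real.volume_Ioo, Real.volume_Ioo, sub_zero,
        sub_zero]
    · rw [Measure.volume_eq_prod, volume_regionBetween_eq_lintegral (by fun_prop) (by fun_prop)
        measurableSet_Ioo]
      simp
end
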